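/- Let n ≥ 1, let μ ∈ ℝ^n, and let σ_1,…,σ_n and τ_1,…,τ_n be positive reals. Let P = ⊗_{i=1}^n N(μ_i, σ_i²) and Q = ⊗_{i=1}^n N(μ_i, τ_i²) be the product probability measures on ℝ^n of one-dimensional Gaussians with common means but possibly different variances, and set λ_i = τ_i²/σ_i² − 1 for each i. Then (1/100) · min{1, √(Σ_{i=1}^n λ_i²)} ≤ TV(P, Q) ≤ (3/2) · min{1, √(Σ_{i=1}^n λ_i²)}. -/

import Mathlib

open MeasureTheory ProbabilityTheory

/-- The total variation distance between two measures:
`TV(P,Q) = sup { |P(S) − Q(S)| : S measurable }`. -/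
noncomputable def tvDist {Ω : Type*} [MeasurableSpace Ω] (P Q : Measure Ω) : ℝ :=
  ⨆ S : {S : Set Ω // MeasurableSet S}, |(P S.1).toReal - (Q S.1).toReal|

section TotalVariation

variable {Ω : Type*} [MeasurableSpace Ω] {ν : Measure Ω} {p q : Ω → ℝ}

lemma withDensity_ofReal_apply_toReal (hp : Integrable p ν) (hp0 : ∀ x, 0 ≤ p x)
    {S : Set Ω} (hS : MeasurableSet S) :
    (ν.withDensity (fun x => ENNReal.ofReal (p x)) S).toReal = ∫ x in S, p x ∂ν := by
  rw [withDensity_apply _ hS, integral_eq_lintegral_of_nonneg_ae (ae_of_all _ hp0)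
    hp.aestronglyMeasurable.restrict]

lemma two_mul_abs_setIntegral_le {d : Ω → ℝ} (hd : Integrable d ν) (h0 : ∫ x, d x ∂ν = 0)
    {S : Set Ω} (hS : MeasurableSet S) :
    2 * |∫ x in S, d x ∂ν| ≤ ∫ x, |d x| ∂ν := by
  have h1 := integral_add_compl hS hd
  have h2 := integral_add_compl hS hd.abs
  have h3 := abs_integral_le_integral_abs (f := d) (μ := ν.restrict S)
  have h4 := abs_integral_le_integral_abs (f := d) (μ := ν.restrict Sᶜ)
  have h5 : ∫ x in Sᶜ, d x ∂ν = -∫ x in S, d x ∂ν := by linarith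
  rw [h5, abs_neg] at h4
  linarith

/-- Total variation distance as half the `L¹` distance of the densities. -/
lemma tvDist_withDensity (hp : Integrable p ν) (hq : Integrable q ν) (hpm : Measurable p)
    (hqm : Measurable q) (hp0 : ∀ x, 0 ≤ p x) (hq0 : ∀ x, 0 ≤ q x)
    (hpq : ∫ x, p x ∂ν = ∫ x, q x ∂ν) :
    tvDist (ν.withDensity fun x => ENNReal.ofReal (p x))
      (ν.withDensity fun x => ENNReal.ofReal (q x)) = (∫ x, |p x - q x| ∂ν) / 2 := by
  have hd : Integrable (fun x => p x - q x) ν := hp.sub hq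
  have h0 : ∫ x, (p x - q x) ∂ν = 0 := by rw [integral_sub hp hq, hpq, sub_self]
  have key : ∀ S : {S : Set Ω // MeasurableSet S},
      |((ν.withDensity fun x => ENNReal.ofReal (p x)) S.1).toReal
        - ((ν.withDensity fun x => ENNReal.ofReal (q x)) S.1).toReal|
        = |∫ x in S.1, (p x - q x) ∂ν| := fun S => by
    rw [withDensity_ofReal_apply_toReal hp hp0 S.2, withDensity_ofReal_apply_toReal hq hq0 S.2,
      integral_sub hp.integrableOn hq.integrableOn]
  unfold tvDist
  simp_rw [key]
  have hub : ∀ S : {S : Set Ω // MeasurableSet S},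
      |∫ x in S.1, (p x - q x) ∂ν| ≤ (∫ x, |p x - q x| ∂ν) / 2 := fun S => by
    linarith [two_mul_abs_setIntegral_le hd h0 S.2]
  refine le_antisymm (@ciSup_le _ _ _ ⟨⟨∅, .empty⟩⟩ _ _ hub) ?_
  have hA : MeasurableSet {x | q x ≤ p x} := measurableSet_le hqm hpm
  refine le_trans ?_ (le_ciSup (f := fun S : {S : Set Ω // MeasurableSet S} =>
    |∫ x in S.1, (p x - q x) ∂ν|) ⟨_, Set.forall_mem_range.2 hub⟩ ⟨_, hA⟩)
  have h1 := integral_add_compl hA hd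
  have h2 := integral_add_compl hA hd.abs
  have h3 : ∫ x in {x | q x ≤ p x}, |p x - q x| ∂ν = ∫ x in {x | q x ≤ p x}, (p x - q x) ∂ν :=
    setIntegral_congr_fun hA fun x hx => abs_of_nonneg (sub_nonneg.2 hx)
  have h4 : ∫ x in {x | q x ≤ p x}ᶜ, |p x - q x| ∂ν
      = ∫ x in {x | q x ≤ p x}ᶜ, -(p x - q x) ∂ν :=
    setIntegral_congr_fun hA.compl fun x hx =>
      abs_of_nonpos (sub_nonpos.2 (le_of_not_ge hx))
  rw [integral_neg] at h4
  have h5 := le_abs_self (∫ x in {x | q x ≤ p x}, (p x - q x) ∂ν)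
  simp only at h5 ⊢
  linarith

lemma norm_integral_sub_integral_le (hp : Integrable p ν) (hq : Integrable q ν)
    (hpm : Measurable p) (hqm : Measurable q) (hp0 : ∀ x, 0 ≤ p x) (hq0 : ∀ x, 0 ≤ q x)
    {f : Ω → ℂ} (hf : Measurable f) (hf1 : ∀ x, ‖f x‖ ≤ 1) :
    ‖(∫ x, f x ∂(ν.withDensity fun x => ENNReal.ofReal (p x)))
      - ∫ x, f x ∂(ν.withDensity fun x => ENNReal.ofReal (q x))‖ ≤ ∫ x, |p x - q x| ∂ν := by
  have h_int : ∀ {r : Ω → ℝ}, Integrable r ν → Integrable (fun x => r x • f x) ν := fun hr =>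
    hr.smul_bdd 1 hf.aestronglyMeasurable (ae_of_all _ hf1)
  rw [integral_withDensity_eq_integral_toReal_smul hpm.ennreal_ofReal (by simp),
    integral_withDensity_eq_integral_toReal_smul hqm.ennreal_ofReal (by simp)]
  simp_rw [ENNReal.toReal_ofReal (hp0 _), ENNReal.toReal_ofReal (hq0 _)]
  rw [← integral_sub (h_int hp) (h_int hq)]
  refine norm_integral_le_of_norm_le (hp.sub hq).abs (ae_of_all _ fun x => ?_)
  rw [← sub_smul, norm_smul, Real.norm_eq_abs]
  exact mul_le_of_le_one_right (abs_nonneg _) (hf1 x)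

/-- Weighted Cauchy–Schwarz bound of the `L¹` distance by the Hellinger affinity. -/
lemma integral_abs_sub_le (hp : Integrable p ν) (hq : Integrable q ν)
    (hp0 : ∀ x, 0 ≤ p x) (hq0 : ∀ x, 0 ≤ q x) (hp1 : ∫ x, p x ∂ν = 1) (hq1 : ∫ x, q x ∂ν = 1)
    (hB : Integrable (fun x => √(p x) * √(q x)) ν) {t : ℝ} (ht : 0 < t) :
    ∫ x, |p x - q x| ∂ν ≤ (1 - ∫ x, √(p x) * √(q x) ∂ν) / t
      + t * (1 + ∫ x, √(p x) * √(q x) ∂ν) := by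
  have hpq : Integrable (fun x => p x + q x) ν := hp.add hq
  have hm : Integrable (fun x => p x + q x - 2 * (√(p x) * √(q x))) ν := hpq.sub (hB.const_mul 2)
  have hs : Integrable (fun x => p x + q x + 2 * (√(p x) * √(q x))) ν := hpq.add (hB.const_mul 2)
  have key : ∀ x, |p x - q x| ≤ (1 / (2 * t)) * (p x + q x - 2 * (√(p x) * √(q x)))
      + (t / 2) * (p x + q x + 2 * (√(p x) * √(q x))) := fun x => by
    have e1 := Real.sq_sqrt (hp0 x)
    have e2 := Real.sq_sqrt (hq0 x)
    have h1 : |p x - q x| = |√(p x) - √(q x)| * (√(p x) + √(q x)) := by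
      have h0 : p x - q x = (√(p x) - √(q x)) * (√(p x) + √(q x)) := by nlinarith
      rw [h0, abs_mul, abs_of_nonneg (a := √(p x) + √(q x)) (by positivity)]
    have h2 : p x + q x - 2 * (√(p x) * √(q x)) = |√(p x) - √(q x)| ^ 2 := by
      rw [sq_abs]; nlinarith
    have h3 : p x + q x + 2 * (√(p x) * √(q x)) = (√(p x) + √(q x)) ^ 2 := by nlinarith
    rw [h1, h2, h3]
    generalize |√(p x) - √(q x)| = u
    generalize √(p x) + √(q x) = v
    have : 1 / (2 * t) * u ^ 2 + t / 2 * v ^ 2 - u * v = (u - t * v) ^ 2 / (2 * t) := by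
      field_simp; ring
    have : 0 ≤ (u - t * v) ^ 2 / (2 * t) := by positivity
    linarith
  refine (integral_mono (hp.sub hq).abs ((hm.const_mul _).add (hs.const_mul _)) key).trans
    (le_of_eq ?_)
  rw [integral_add' (hm.const_mul _) (hs.const_mul _), integral_const_mul, integral_const_mul,
    integral_sub hpq (hB.const_mul 2), integral_add hpq (hB.const_mul 2),
    integral_add hp hq, integral_const_mul, hp1, hq1]
  field_simp
  ring

end TotalVariation

lemma pi_withDensity_ofReal {ι : Type*} [Fintype ι] {p : ι → ℝ → ℝ}
    (hp : ∀ i, Integrable (p i)) (hp0 : ∀ i x, 0 ≤ p i x) :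
    Measure.pi (fun i => (volume : Measure ℝ).withDensity fun x => ENNReal.ofReal (p i x))
      = (volume : Measure (ι → ℝ)).withDensity fun x => ENNReal.ofReal (∏ i, p i (x i)) := by
  have : ∀ i, IsFiniteMeasure
      ((volume : Measure ℝ).withDensity fun x => ENNReal.ofReal (p i x)) := fun i =>
    isFiniteMeasure_withDensity_ofReal (hp i).2
  refine Measure.pi_eq fun s hs => ?_
  rw [withDensity_apply _ (.univ_pi hs), volume_pi, Measure.restrict_pi_pi,
    ← ofReal_integral_eq_lintegral_ofReal
      (Integrable.fintype_prod fun i => (hp i).integrableOn)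
      (ae_of_all _ fun x => Finset.prod_nonneg fun i _ => hp0 i (x i)),
    integral_fintype_prod_eq_prod, ENNReal.ofReal_prod_of_nonneg
      fun i _ => integral_nonneg (hp0 i)]
  refine Finset.prod_congr rfl fun i _ => ?_
  rw [withDensity_apply _ (hs i), ofReal_integral_eq_lintegral_ofReal (hp i).integrableOn
    (ae_of_all _ (hp0 i))]

lemma norm_prod_one_add_sub_one_sub_sum_le {ι : Type*} (s : Finset ι) (w : ι → ℂ) :
    ‖∏ i ∈ s, (1 + w i) - 1 - ∑ i ∈ s, w i‖
      ≤ Real.exp (∑ i ∈ s, ‖w i‖) - 1 - ∑ i ∈ s, ‖w i‖ := by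
  classical
  induction s using Finset.induction_on with
  | empty => simp
  | insert j s hj ih =>
    rw [Finset.prod_insert hj, Finset.sum_insert hj, Finset.sum_insert hj, Real.exp_add]
    have hT : ‖∑ i ∈ s, w i‖ ≤ ∑ i ∈ s, ‖w i‖ := norm_sum_le _ _
    generalize (∏ i ∈ s, (1 + w i)) = R at *
    generalize (∑ i ∈ s, w i) = S at *
    generalize (∑ i ∈ s, ‖w i‖) = T at *
    have h1 : (1 + w j) * R - 1 - (w j + S) = (1 + w j) * (R - 1 - S) + w j * S := by ring
    have h2 : ‖1 + w j‖ ≤ 1 + ‖w j‖ := (norm_add_le _ _).trans (by simp)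
    have h3 := Real.add_one_le_exp ‖w j‖
    have h4 := Real.exp_pos T
    calc ‖(1 + w j) * R - 1 - (w j + S)‖
        ≤ ‖1 + w j‖ * ‖R - 1 - S‖ + ‖w j‖ * ‖S‖ := by
          rw [h1, ← norm_mul, ← norm_mul]; exact norm_add_le _ _
      _ ≤ (1 + ‖w j‖) * (Real.exp T - 1 - T) + ‖w j‖ * T := by gcongr
      _ ≤ _ := by nlinarith

lemma one_sub_prod_le_sum {ι : Type*} (s : Finset ι) {b : ι → ℝ}
    (h0 : ∀ i, 0 ≤ b i) (h1 : ∀ i, b i ≤ 1) :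
    1 - ∏ i ∈ s, b i ≤ ∑ i ∈ s, (1 - b i) := by
  classical
  induction s using Finset.induction_on with
  | empty => simp
  | insert j s hj ih =>
    rw [Finset.prod_insert hj, Finset.sum_insert hj]
    have h2 : ∏ i ∈ s, b i ≤ 1 := Finset.prod_le_one (fun i _ => h0 i) fun i _ => h1 i
    nlinarith [h0 j, h1 j]

/-- Quantitative separation of two complex numbers whose squares are the products
`∏ (1 - i a)⁻¹` and `∏ (1 - i a (1 + l))⁻¹`. -/
lemma le_norm_sub_of_sq_eq_prod {ι : Type*} [Fintype ι] {a l : ι → ℝ} {x : ℝ} {u v : ℂ}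
    (hal : ∀ i, 0 ≤ a i * l i) (ha : ∀ i, |a i| ≤ 1 / 2) (hx : ∑ i, a i * l i = x)
    (hx2 : x ≤ 1 / 2) (hb : ∑ i, (a i * (1 + l i)) ^ 2 ≤ 1)
    (hu : ‖u‖ ≤ 1) (hv : ‖v‖ ≤ 1)
    (hu2 : u ^ 2 = ∏ i, (1 - Complex.I * a i)⁻¹)
    (hv2 : v ^ 2 = ∏ i, (1 - Complex.I * ((a i * (1 + l i) : ℝ) : ℂ))⁻¹) :
    3 / 40 * x ≤ ‖u - v‖ := by
  have hns : ∀ r : ℝ, Complex.normSq (1 - Complex.I * r) = 1 + r ^ 2 := fun r => by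
    simp [Complex.normSq_apply]; ring
  have hne : ∀ r : ℝ, (1 - Complex.I * r : ℂ) ≠ 0 := fun r h => by
    have := hns r
    rw [h, map_zero] at this
    nlinarith
  set w : ι → ℂ := fun i => -(Complex.I * ((a i * l i : ℝ) : ℂ)) / (1 - Complex.I * a i) with hw
  have hfac : u ^ 2 = v ^ 2 * ∏ i, (1 + w i) := by
    rw [hu2, hv2, ← Finset.prod_mul_distrib]
    refine Finset.prod_congr rfl fun i _ => ?_
    have h1 := hne (a i)
    have h2 := hne (a i * (1 + l i))
    rw [hw]
    field_simp
    push_cast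
    ring
  have hwn : ∀ i, ‖w i‖ ≤ a i * l i := fun i => by
    have h1 : (1 : ℝ) ≤ ‖1 - Complex.I * a i‖ := by
      rw [← abs_of_nonneg (norm_nonneg (1 - Complex.I * (a i : ℂ))), ← one_le_sq_iff_one_le_abs,
        Complex.sq_norm, hns]
      nlinarith [sq_nonneg (a i)]
    rw [hw]
    simp only [norm_div, norm_neg, norm_mul, Complex.norm_I, one_mul, Complex.norm_real,
      Real.norm_eq_abs]
    rw [← abs_mul, abs_of_nonneg (hal i)]
    exact div_le_self (hal i) h1
  have him : ∀ i, 4 / 5 * (a i * l i) ≤ -(w i).im := fun i => by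
    have h1 : (w i).im = -(a i * l i) / (1 + a i ^ 2) := by
      rw [hw]
      simp only [Complex.div_im, hns]
      simp
    have h2 : a i ^ 2 ≤ 1 / 4 := by
      have := sq_le_sq' (by linarith [abs_nonneg (a i), ha i]) (ha i)
      rw [sq_abs] at this
      linarith
    rw [h1, neg_div, neg_neg, le_div_iff₀ (by positivity)]
    nlinarith [hal i]
  have hsum : 4 / 5 * x ≤ ‖∑ i, w i‖ := by
    calc 4 / 5 * x ≤ ∑ i, -(w i).im := by
          rw [← hx, Finset.mul_sum]; exact Finset.sum_le_sum fun i _ => him i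
      _ = -(∑ i, w i).im := by rw [Finset.sum_neg_distrib, Complex.im_sum]
      _ ≤ ‖∑ i, w i‖ := (neg_le_abs _).trans (Complex.abs_im_le_norm _)
  set T := ∑ i, ‖w i‖ with hT
  have hT0 : 0 ≤ T := Finset.sum_nonneg fun i _ => norm_nonneg _
  have hTx : T ≤ x := hx ▸ Finset.sum_le_sum fun i _ => hwn i
  have herr : ‖∏ i, (1 + w i) - 1 - ∑ i, w i‖ ≤ x / 2 := by
    refine (norm_prod_one_add_sub_one_sub_sum_le _ w).trans ?_
    have h1 := Real.abs_exp_sub_one_sub_id_le (x := T) (by rw [abs_of_nonneg hT0]; linarith)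
    have h2 := (le_abs_self _).trans h1
    nlinarith
  have hprod : 3 / 10 * x ≤ ‖∏ i, (1 + w i) - 1‖ := by
    have h1 : ∑ i, w i = (∏ i, (1 + w i) - 1) - (∏ i, (1 + w i) - 1 - ∑ i, w i) := by ring
    have h2 := norm_sub_le (∏ i, (1 + w i) - 1) (∏ i, (1 + w i) - 1 - ∑ i, w i)
    rw [← h1] at h2
    linarith
  have hvn : 1 / 2 ≤ ‖v ^ 2‖ := by
    have h1 : ‖v ^ 2‖ ^ 2 = (∏ i, (1 + (a i * (1 + l i)) ^ 2))⁻¹ := by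
      rw [Complex.sq_norm, hv2, map_prod, ← Finset.prod_inv_distrib]
      exact Finset.prod_congr rfl fun i _ => by rw [map_inv₀, hns]
    have h2 : ∏ i, (1 + (a i * (1 + l i)) ^ 2) ≤ 4 :=
      calc _ ≤ ∏ i, Real.exp ((a i * (1 + l i)) ^ 2) :=
            Finset.prod_le_prod (fun i _ => by positivity) fun i _ => by
              rw [add_comm]; exact Real.add_one_le_exp _
        _ = Real.exp (∑ i, (a i * (1 + l i)) ^ 2) := (Real.exp_sum _ _).symm
        _ ≤ Real.exp 1 := Real.exp_le_exp.2 hb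
        _ ≤ 4 := by linarith [Real.exp_one_lt_d9]
    have h3 : (4 : ℝ)⁻¹ ≤ ‖v ^ 2‖ ^ 2 := by
      rw [h1]
      exact inv_anti₀ (Finset.prod_pos fun i _ => by positivity) h2
    nlinarith [norm_nonneg (v ^ 2)]
  have hdiff : ‖u - v‖ * ‖u + v‖ = ‖v ^ 2‖ * ‖∏ i, (1 + w i) - 1‖ := by
    rw [← norm_mul, ← norm_mul]
    congr 1
    linear_combination hfac
  have huv : ‖u + v‖ ≤ 2 := (norm_add_le _ _).trans (by linarith)
  have hx0 : 0 ≤ x := hT0.trans hTx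
  have h1 : 1 / 2 * (3 / 10 * x) ≤ ‖v ^ 2‖ * ‖∏ i, (1 + w i) - 1‖ := by gcongr
  have h2 : ‖u - v‖ * ‖u + v‖ ≤ ‖u - v‖ * 2 := by gcongr
  linarith

lemma sq_integral_cexp_mul_sq_gaussianReal (m c : ℝ) {v : NNReal} (hv : v ≠ 0) :
    (∫ x, Complex.exp (Complex.I * ((c * (x - m) ^ 2 : ℝ) : ℂ)) ∂gaussianReal m v) ^ 2
      = (1 - Complex.I * ((2 * c * v : ℝ) : ℂ))⁻¹ := by
  have hv0 : (0 : ℝ) < v := by positivity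
  have hvC : (v : ℂ) ≠ 0 := by exact_mod_cast hv
  set b : ℂ := ((1 / (2 * v) : ℝ) : ℂ) - Complex.I * c with hb
  have hbre : 0 < b.re := by
    simp only [hb, Complex.sub_re, Complex.ofReal_re, Complex.I_mul_re, Complex.ofReal_im]
    simp only [neg_zero, sub_zero]
    positivity
  have hb0 : b ≠ 0 := fun h => by rw [h] at hbre; simp at hbre
  have hshift : ∀ x : ℝ, gaussianPDFReal m v x •
        Complex.exp (Complex.I * ((c * (x - m) ^ 2 : ℝ) : ℂ))
      = (fun y : ℝ =>
        (((√(2 * Real.pi * v))⁻¹ : ℝ) : ℂ) * Complex.exp (-b * (y : ℂ) ^ 2)) (x - m) := by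
    intro x
    simp only [gaussianPDFReal, Complex.real_smul, Complex.ofReal_mul, mul_assoc,
      Complex.ofReal_exp]
    congr 1
    rw [← Complex.exp_add]
    congr 1
    rw [hb]
    push_cast
    field_simp
    ring
  rw [integral_gaussianReal_eq_integral_smul hv]
  simp_rw [hshift]
  rw [integral_sub_right_eq_self (fun y : ℝ =>
      (((√(2 * Real.pi * v))⁻¹ : ℝ) : ℂ) * Complex.exp (-b * (y : ℂ) ^ 2)) m,
    integral_const_mul, integral_gaussian_complex hbre, mul_pow, ← Complex.cpow_nat_mul]
  have h1 : (((√(2 * Real.pi * v))⁻¹ : ℝ) : ℂ) ^ 2 = (2 * Real.pi * v)⁻¹ := by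
    rw [← Complex.ofReal_pow, inv_pow, Real.sq_sqrt (by positivity)]
  have hpi : (Real.pi : ℂ) ≠ 0 := by exact_mod_cast Real.pi_ne_zero
  rw [h1]
  have h2 : 1 - Complex.I * ((2 * c * v : ℝ) : ℂ) = 2 * v * b := by
    rw [hb]
    push_cast
    field_simp
  rw [h2]
  push_cast
  rw [mul_one_div_cancel two_ne_zero, Complex.cpow_one]
  field_simp

lemma sqrt_gaussianPDFReal_mul (m : ℝ) (v w : NNReal) (x : ℝ) :
    √(gaussianPDFReal m v x) * √(gaussianPDFReal m w x)
      = √((√(2 * Real.pi * v))⁻¹ * (√(2 * Real.pi * w))⁻¹)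
        * Real.exp (-((1 / v + 1 / w) / 4) * (x - m) ^ 2) := by
  rw [← Real.sqrt_mul (gaussianPDFReal_nonneg _ _ _)]
  have : gaussianPDFReal m v x * gaussianPDFReal m w x =
      ((√(2 * Real.pi * v))⁻¹ * (√(2 * Real.pi * w))⁻¹)
        * Real.exp (-((1 / v + 1 / w) / 4) * (x - m) ^ 2) ^ 2 := by
    simp only [gaussianPDFReal]
    rw [← Real.exp_nat_mul, mul_mul_mul_comm, ← Real.exp_add]
    congr 2
    push_cast
    by_cases hv : (v : ℝ) = 0 <;> by_cases hw : (w : ℝ) = 0 <;>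
      simp [hv, hw] <;> field_simp <;> ring
  rw [this, Real.sqrt_mul (by positivity), Real.sqrt_sq (Real.exp_pos _).le]

lemma integrable_sqrt_gaussianPDFReal_mul (m : ℝ) {v w : NNReal} (hv : v ≠ 0) (hw : w ≠ 0) :
    Integrable fun x => √(gaussianPDFReal m v x) * √(gaussianPDFReal m w x) := by
  simp_rw [sqrt_gaussianPDFReal_mul]
  have hv0 : (0 : ℝ) < v := by positivity
  have hw0 : (0 : ℝ) < w := by positivity
  exact ((integrable_exp_neg_mul_sq
    (by positivity : (0 : ℝ) < (1 / v + 1 / w) / 4)).comp_sub_right m).const_mul _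

lemma sq_integral_sqrt_gaussianPDFReal_mul (m : ℝ) {v w : NNReal} {s t : ℝ} (hs : 0 < s)
    (ht : 0 < t) (hv : (v : ℝ) = s ^ 2) (hw : (w : ℝ) = t ^ 2) :
    (∫ x, √(gaussianPDFReal m v x) * √(gaussianPDFReal m w x)) ^ 2
      = 2 * s * t / (s ^ 2 + t ^ 2) := by
  simp_rw [sqrt_gaussianPDFReal_mul]
  rw [hv, hw]
  rw [integral_const_mul, integral_sub_right_eq_self
    (fun y : ℝ => Real.exp (-((1 / s ^ 2 + 1 / t ^ 2) / 4) * y ^ 2)) m, integral_gaussian,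
    mul_pow, Real.sq_sqrt (by positivity), Real.sq_sqrt (by positivity),
    Real.sqrt_mul (x := 2 * Real.pi) (by positivity) (s ^ 2),
    Real.sqrt_mul (x := 2 * Real.pi) (by positivity) (t ^ 2), Real.sqrt_sq hs.le,
    Real.sqrt_sq ht.le]
  have h1 : √(2 * Real.pi) ^ 2 = 2 * Real.pi := Real.sq_sqrt (by positivity)
  have hpi := Real.pi_pos
  rw [← mul_inv, show √(2 * Real.pi) * s * (√(2 * Real.pi) * t) = 2 * Real.pi * (s * t) by
    linear_combination s * t * h1]
  field_simp
  ring

lemma one_sub_affinity_le {s t B : ℝ} (hs : 0 < s) (ht : 0 < t) (hB : 0 ≤ B)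
    (h : B ^ 2 = 2 * s * t / (s ^ 2 + t ^ 2)) :
    B ≤ 1 ∧ 1 - B ≤ (t ^ 2 / s ^ 2 - 1) ^ 2 := by
  have h1 : 1 - B ^ 2 = (s - t) ^ 2 / (s ^ 2 + t ^ 2) := by rw [h]; field_simp; ring
  have h2 : 0 ≤ 1 - B ^ 2 := by rw [h1]; positivity
  have h3 : 1 - B ^ 2 ≤ (t ^ 2 / s ^ 2 - 1) ^ 2 := by
    have e : (t ^ 2 / s ^ 2 - 1) ^ 2 = (s - t) ^ 2 * ((s + t) ^ 2 / s ^ 4) := by field_simp; ring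
    rw [h1, e, div_eq_mul_one_div]
    refine mul_le_mul_of_nonneg_left ?_ (sq_nonneg _)
    rw [div_le_div_iff₀ (by positivity) (by positivity)]
    have : 0 < s * t := by positivity
    nlinarith [pow_pos hs 3, pow_pos hs 4, mul_pos (pow_pos hs 3) ht,
      mul_pos (pow_pos hs 2) (pow_pos ht 2), mul_pos hs (pow_pos ht 3), pow_pos ht 4]
  have h4 : B ≤ 1 := by nlinarith
  exact ⟨h4, by nlinarith⟩

section GaussianProduct

variable {ι : Type*} [Fintype ι] {m : ι → ℝ} {v w : ι → NNReal} {s t : ι → ℝ}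

lemma pi_gaussianReal_eq_withDensity (m : ι → ℝ) (hv : ∀ i, v i ≠ 0) :
    Measure.pi (fun i => gaussianReal (m i) (v i))
      = (volume : Measure (ι → ℝ)).withDensity
        fun x => ENNReal.ofReal (∏ i, gaussianPDFReal (m i) (v i) (x i)) := by
  rw [← pi_withDensity_ofReal (fun i => integrable_gaussianPDFReal (m i) (v i))
    fun i => gaussianPDFReal_nonneg (m i) (v i)]
  exact congrArg _ (funext fun i => gaussianReal_of_var_ne_zero (m i) (hv i))

lemma integrable_prod_gaussianPDFReal (m : ι → ℝ) (v : ι → NNReal) :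
    Integrable fun x : ι → ℝ => ∏ i, gaussianPDFReal (m i) (v i) (x i) :=
  Integrable.fintype_prod fun i => integrable_gaussianPDFReal (m i) (v i)

lemma measurable_prod_gaussianPDFReal (m : ι → ℝ) (v : ι → NNReal) :
    Measurable fun x : ι → ℝ => ∏ i, gaussianPDFReal (m i) (v i) (x i) :=
  Finset.measurable_fun_prod _ fun i _ =>
    (measurable_gaussianPDFReal (m i) (v i)).comp (measurable_pi_apply i)

lemma prod_gaussianPDFReal_nonneg (m : ι → ℝ) (v : ι → NNReal) (x : ι → ℝ) :
    0 ≤ ∏ i, gaussianPDFReal (m i) (v i) (x i) :=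
  Finset.prod_nonneg fun i _ => gaussianPDFReal_nonneg (m i) (v i) (x i)

lemma integral_prod_gaussianPDFReal (m : ι → ℝ) (hv : ∀ i, v i ≠ 0) :
    ∫ x : ι → ℝ, ∏ i, gaussianPDFReal (m i) (v i) (x i) = 1 := by
  rw [integral_fintype_prod_volume_eq_prod fun i => gaussianPDFReal (m i) (v i)]
  exact Finset.prod_eq_one fun i _ => integral_gaussianPDFReal_eq_one (m i) (hv i)

lemma tvDist_pi_gaussianReal (m : ι → ℝ) (hv : ∀ i, v i ≠ 0) (hw : ∀ i, w i ≠ 0) :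
    tvDist (Measure.pi fun i => gaussianReal (m i) (v i))
      (Measure.pi fun i => gaussianReal (m i) (w i))
      = (∫ x : ι → ℝ, |∏ i, gaussianPDFReal (m i) (v i) (x i)
          - ∏ i, gaussianPDFReal (m i) (w i) (x i)|) / 2 := by
  rw [pi_gaussianReal_eq_withDensity m hv, pi_gaussianReal_eq_withDensity m hw]
  exact tvDist_withDensity (integrable_prod_gaussianPDFReal m v)
    (integrable_prod_gaussianPDFReal m w) (measurable_prod_gaussianPDFReal m v)
    (measurable_prod_gaussianPDFReal m w) (prod_gaussianPDFReal_nonneg m v)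
    (prod_gaussianPDFReal_nonneg m w)
    ((integral_prod_gaussianPDFReal m hv).trans (integral_prod_gaussianPDFReal m hw).symm)

lemma tvDist_pi_gaussianReal_le (m : ι → ℝ) (hs : ∀ i, 0 < s i) (ht : ∀ i, 0 < t i)
    (hv : ∀ i, (v i : ℝ) = s i ^ 2) (hw : ∀ i, (w i : ℝ) = t i ^ 2) :
    tvDist (Measure.pi fun i => gaussianReal (m i) (v i))
      (Measure.pi fun i => gaussianReal (m i) (w i))
      ≤ 3 / 2 * min 1 √(∑ i, (t i ^ 2 / s i ^ 2 - 1) ^ 2) := by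
  have hv0 : ∀ i, v i ≠ 0 := fun i h => by
    have := hv i; rw [h] at this; exact (pow_pos (hs i) 2).ne this
  have hw0 : ∀ i, w i ≠ 0 := fun i h => by
    have := hw i; rw [h] at this; exact (pow_pos (ht i) 2).ne this
  set B : ι → ℝ := fun i =>
    ∫ x, √(gaussianPDFReal (m i) (v i) x) * √(gaussianPDFReal (m i) (w i) x) with hB
  have hB0 : ∀ i, 0 ≤ B i := fun i => integral_nonneg fun x => by positivity
  have hB1 := fun i => one_sub_affinity_le (hs i) (ht i) (hB0 i)
    (sq_integral_sqrt_gaussianPDFReal_mul (m i) (hs i) (ht i) (hv i) (hw i))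
  have hfac : (fun x : ι → ℝ => √(∏ i, gaussianPDFReal (m i) (v i) (x i))
        * √(∏ i, gaussianPDFReal (m i) (w i) (x i)))
      = fun x => ∏ i, √(gaussianPDFReal (m i) (v i) (x i))
        * √(gaussianPDFReal (m i) (w i) (x i)) := funext fun x => by
    rw [Real.sqrt_prod _ fun i _ => gaussianPDFReal_nonneg _ _ _,
      Real.sqrt_prod _ fun i _ => gaussianPDFReal_nonneg _ _ _, Finset.prod_mul_distrib]
  have h_int : Integrable (fun x : ι → ℝ => √(∏ i, gaussianPDFReal (m i) (v i) (x i))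
        * √(∏ i, gaussianPDFReal (m i) (w i) (x i))) := by
    rw [hfac]
    exact Integrable.fintype_prod (f := fun i x => √(gaussianPDFReal (m i) (v i) x)
      * √(gaussianPDFReal (m i) (w i) x)) fun i =>
        integrable_sqrt_gaussianPDFReal_mul (m i) (hv0 i) (hw0 i)
  have haff : ∫ x : ι → ℝ, √(∏ i, gaussianPDFReal (m i) (v i) (x i))
        * √(∏ i, gaussianPDFReal (m i) (w i) (x i)) = ∏ i, B i := by
    rw [hfac]
    exact integral_fintype_prod_volume_eq_prod fun i x => √(gaussianPDFReal (m i) (v i) x)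
      * √(gaussianPDFReal (m i) (w i) x)
  have hL1 : ∀ r : ℝ, 0 < r → _ := fun r hr =>
    integral_abs_sub_le (integrable_prod_gaussianPDFReal m v)
      (integrable_prod_gaussianPDFReal m w) (prod_gaussianPDFReal_nonneg m v)
      (prod_gaussianPDFReal_nonneg m w) (integral_prod_gaussianPDFReal m hv0)
      (integral_prod_gaussianPDFReal m hw0) h_int hr
  rw [haff] at hL1
  have hprod1 : ∏ i, B i ≤ 1 := Finset.prod_le_one (fun i _ => hB0 i) fun i _ => (hB1 i).1
  have hsum : 1 - ∏ i, B i ≤ ∑ i, (t i ^ 2 / s i ^ 2 - 1) ^ 2 :=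
    (one_sub_prod_le_sum _ hB0 fun i => (hB1 i).1).trans
      (Finset.sum_le_sum fun i _ => (hB1 i).2)
  rw [tvDist_pi_gaussianReal m hv0 hw0, mul_min_of_nonneg _ _ (by norm_num)]
  refine le_min ?_ ?_
  · linarith [hL1 1 one_pos]
  · refine le_of_forall_pos_le_add fun ε hε => ?_
    set L := √(∑ i, (t i ^ 2 / s i ^ 2 - 1) ^ 2) with hL
    have hL0 : 0 ≤ L := Real.sqrt_nonneg _
    have hLsq : L ^ 2 = ∑ i, (t i ^ 2 / s i ^ 2 - 1) ^ 2 :=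
      Real.sq_sqrt (Finset.sum_nonneg fun i _ => sq_nonneg _)
    have hr : 0 < L + ε / 2 := by positivity
    have h1 := hL1 _ hr
    have h2 : (1 - ∏ i, B i) / (L + ε / 2) ≤ L + ε / 2 := by
      rw [div_le_iff₀ hr]
      nlinarith
    have h3 : (L + ε / 2) * (1 + ∏ i, B i) ≤ (L + ε / 2) * 2 := by gcongr; linarith
    linarith

lemma sq_integral_cexp_sum_pi_gaussianReal (m c : ι → ℝ) (hv : ∀ i, v i ≠ 0) :
    (∫ x : ι → ℝ, Complex.exp (Complex.I * ((∑ i, c i * (x i - m i) ^ 2 : ℝ) : ℂ))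
        ∂Measure.pi fun i => gaussianReal (m i) (v i)) ^ 2
      = ∏ i, (1 - Complex.I * ((2 * c i * v i : ℝ) : ℂ))⁻¹ := by
  simp_rw [Complex.ofReal_sum, Finset.mul_sum, Complex.exp_sum]
  rw [integral_fintype_prod_eq_prod (fun i (x : ℝ) =>
    Complex.exp (Complex.I * ((c i * (x - m i) ^ 2 : ℝ) : ℂ))), ← Finset.prod_pow]
  exact Finset.prod_congr rfl fun i _ => sq_integral_cexp_mul_sq_gaussianReal (m i) (c i) (hv i)

lemma le_tvDist_pi_gaussianReal (m : ι → ℝ) (hs : ∀ i, 0 < s i) (ht : ∀ i, 0 < t i)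
    (hv : ∀ i, (v i : ℝ) = s i ^ 2) (hw : ∀ i, (w i : ℝ) = t i ^ 2) :
    1 / 100 * min 1 √(∑ i, (t i ^ 2 / s i ^ 2 - 1) ^ 2)
      ≤ tvDist (Measure.pi fun i => gaussianReal (m i) (v i))
        (Measure.pi fun i => gaussianReal (m i) (w i)) := by
  have hv0 : ∀ i, v i ≠ 0 := fun i h => by
    have := hv i; rw [h] at this; exact (pow_pos (hs i) 2).ne this
  have hw0 : ∀ i, w i ≠ 0 := fun i h => by
    have := hw i; rw [h] at this; exact (pow_pos (ht i) 2).ne this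
  set l : ι → ℝ := fun i => t i ^ 2 / s i ^ 2 - 1 with hl
  set L := √(∑ i, l i ^ 2) with hL
  rw [tvDist_pi_gaussianReal m hv0 hw0]
  have hL0 : 0 ≤ L := Real.sqrt_nonneg _
  rcases hL0.eq_or_lt with h0 | hLpos
  · rw [← h0, min_eq_right zero_le_one, mul_zero]
    exact div_nonneg (integral_nonneg fun x => abs_nonneg _) zero_le_two
  have hLne : L ≠ 0 := hLpos.ne'
  have hLsq : L ^ 2 = ∑ i, l i ^ 2 := Real.sq_sqrt (Finset.sum_nonneg fun i _ => sq_nonneg _)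
  have hlL : ∀ i, |l i| ≤ L := fun i => Real.abs_le_sqrt
    (Finset.single_le_sum (f := fun i => l i ^ 2) (fun i _ => sq_nonneg _) (Finset.mem_univ i))
  set M := max 1 L with hM
  have hM1 : 1 ≤ M := le_max_left _ _
  have hML : L ≤ M := le_max_right _ _
  have hM0 : 0 < M := by linarith
  have hmin : min 1 L = L / M := by
    rw [eq_div_iff hM0.ne', hM, min_mul_max, one_mul]
  set k := 1 / (2 * L * M) with hk
  have hk0 : 0 < k := by positivity
  set a : ι → ℝ := fun i => k * l i with ha
  set c : ι → ℝ := fun i => a i / (2 * s i ^ 2) with hc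
  set f : (ι → ℝ) → ℂ := fun x =>
    Complex.exp (Complex.I * ((∑ i, c i * (x i - m i) ^ 2 : ℝ) : ℂ)) with hf
  have hf1 : ∀ x, ‖f x‖ = 1 := fun x => Complex.norm_exp_I_mul_ofReal _
  have hfm : Measurable f := by
    rw [hf]
    fun_prop
  have hnorm : ∀ (ρ : Measure (ι → ℝ)) [IsProbabilityMeasure ρ], ‖∫ x, f x ∂ρ‖ ≤ 1 := by
    intro ρ _
    simpa using norm_integral_le_of_norm_le_const (μ := ρ) (ae_of_all _ fun x => (hf1 x).le)
  have htest := norm_integral_sub_integral_le (integrable_prod_gaussianPDFReal m v)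
    (integrable_prod_gaussianPDFReal m w) (measurable_prod_gaussianPDFReal m v)
    (measurable_prod_gaussianPDFReal m w) (prod_gaussianPDFReal_nonneg m v)
    (prod_gaussianPDFReal_nonneg m w) hfm fun x => (hf1 x).le
  rw [← pi_gaussianReal_eq_withDensity m hv0, ← pi_gaussianReal_eq_withDensity m hw0] at htest
  have hal : ∑ i, a i * l i = L / (2 * M) := by
    calc ∑ i, a i * l i = k * ∑ i, l i ^ 2 := by
          rw [Finset.mul_sum]; exact Finset.sum_congr rfl fun i _ => by rw [ha]; ring
      _ = L / (2 * M) := by rw [← hLsq, hk]; field_simp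
  have hgap := le_norm_sub_of_sq_eq_prod (a := a) (l := l) (x := L / (2 * M))
    (u := ∫ x, f x ∂Measure.pi fun i => gaussianReal (m i) (v i))
    (v := ∫ x, f x ∂Measure.pi fun i => gaussianReal (m i) (w i))
    (fun i => by
      have : a i * l i = k * l i ^ 2 := by rw [ha]; ring
      rw [this]; positivity)
    (fun i => by
      rw [ha]
      simp only [abs_mul, abs_of_pos hk0]
      calc k * |l i| ≤ k * L := by gcongr; exact hlL i
        _ = 1 / (2 * M) := by rw [hk]; field_simp
        _ ≤ 1 / 2 := by gcongr; linarith)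
    hal
    (by rw [div_le_div_iff₀ (by positivity) two_pos]; linarith)
    (by
      calc ∑ i, (a i * (1 + l i)) ^ 2 ≤ ∑ i, k ^ 2 * (2 * M) ^ 2 * l i ^ 2 := by
            refine Finset.sum_le_sum fun i _ => ?_
            have h1 : |1 + l i| ≤ 2 * M :=
              (abs_add_le _ _).trans (by rw [abs_one]; linarith [hlL i])
            have h2 : (1 + l i) ^ 2 ≤ (2 * M) ^ 2 :=
              sq_le_sq.2 (h1.trans (le_abs_self _))
            calc (a i * (1 + l i)) ^ 2 = k ^ 2 * l i ^ 2 * (1 + l i) ^ 2 := by rw [ha]; ring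
              _ ≤ k ^ 2 * l i ^ 2 * (2 * M) ^ 2 := by gcongr
              _ = _ := by ring
        _ = 1 := by rw [← Finset.mul_sum, ← hLsq, hk]; field_simp)
    (hnorm _) (hnorm _)
    (by
      rw [sq_integral_cexp_sum_pi_gaussianReal m c hv0]
      refine Finset.prod_congr rfl fun i _ => ?_
      have h1 := (hs i).ne'
      have : 2 * c i * v i = a i := by rw [hc, hv i]; field_simp
      rw [this])
    (by
      rw [sq_integral_cexp_sum_pi_gaussianReal m c hw0]
      refine Finset.prod_congr rfl fun i _ => ?_
      have h1 := (hs i).ne'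
      have : 2 * c i * w i = a i * (1 + l i) := by
        simp only [hc, hl, hw i]; field_simp; ring
      rw [this])
  rw [hmin]
  have h1 : L / (2 * M) = L / M / 2 := by rw [div_div, mul_comm]
  have h2 : 0 ≤ L / M := by positivity
  rw [h1] at hgap
  linarith

end GaussianProduct

theorem tv_gaussian_same_mean
    (n : ℕ) (hn : 1 ≤ n) (μ : Fin n → ℝ) (σ τ : Fin n → ℝ)
    (hσ : ∀ i, 0 < σ i) (hτ : ∀ i, 0 < τ i)
    (P Q : Measure (Fin n → ℝ))
    (hP : P = Measure.pi fun i => gaussianReal (μ i) ⟨(σ i) ^ 2, sq_nonneg _⟩)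
    (hQ : Q = Measure.pi fun i => gaussianReal (μ i) ⟨(τ i) ^ 2, sq_nonneg _⟩)
    (lam : Fin n → ℝ) (hlam : ∀ i, lam i = (τ i) ^ 2 / (σ i) ^ 2 - 1) :
    (1 / 100) * min 1 (Real.sqrt (∑ i, (lam i) ^ 2)) ≤ tvDist P Q ∧
      tvDist P Q ≤ (3 / 2) * min 1 (Real.sqrt (∑ i, (lam i) ^ 2)) := by
  subst hP hQ
  obtain rfl : lam = fun i => τ i ^ 2 / σ i ^ 2 - 1 := funext hlam
  exact ⟨le_tvDist_pi_gaussianReal μ hσ hτ (fun _ => rfl) fun _ => rfl,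
    tvDist_pi_gaussianReal_le μ hσ hτ (fun _ => rfl) fun _ => rfl⟩
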